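/- For all x > 0 and y > 0: ∂³BS_Put/∂y³ (x,y) = (x·φ(d_+(x,y))/(8·y^{5/2})) · ( (d_−(x,y)·d_+(x,y) − 2)² − d_+(x,y)² − d_−(x,y)² − 1 ). -/

import Mathlib

/-- Density of the standard normal distribution. -/
noncomputable def stdGaussianPDF (z : ℝ) : ℝ :=
  (Real.sqrt (2 * Real.pi))⁻¹ * Real.exp (-z ^ 2 / 2)

/-- Cumulative distribution function of the standard normal distribution. -/
noncomputable def stdGaussianCDF (z : ℝ) : ℝ :=
  ∫ t in Set.Iic z, stdGaussianPDF t

/-- d₊ from the Black–Scholes formula. -/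
noncomputable def dPlus (K r T x y : ℝ) : ℝ :=
  (Real.log (x / K) + r * T + y / 2) / Real.sqrt y

/-- d₋ from the Black–Scholes formula. -/
noncomputable def dMinus (K r T x y : ℝ) : ℝ :=
  (Real.log (x / K) + r * T - y / 2) / Real.sqrt y

/-- Black–Scholes put price with strike `K`, interest rate `r`, maturity `T`,
spot `x` and integrated variance `y`. -/
noncomputable def BSPut (K r T x y : ℝ) : ℝ :=
  K * Real.exp (-(r * T)) * stdGaussianCDF (-(dMinus K r T x y)) -
    x * stdGaussianCDF (-(dPlus K r T x y))

theorem continuous_stdGaussianPDF : Continuous stdGaussianPDF := by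
  unfold stdGaussianPDF
  fun_prop

theorem integrable_stdGaussianPDF : MeasureTheory.Integrable stdGaussianPDF := by
  unfold stdGaussianPDF
  refine MeasureTheory.Integrable.const_mul ?_ _
  refine (integrable_exp_neg_mul_sq (b := 1 / 2) (by norm_num)).congr (.of_forall fun z => ?_)
  ring_nf

theorem hasDerivAt_stdGaussianCDF (z : ℝ) :
    HasDerivAt stdGaussianCDF (stdGaussianPDF z) z := by
  have h : stdGaussianCDF =
      fun z => (∫ t in (0 : ℝ)..z, stdGaussianPDF t) + stdGaussianCDF 0 := by
    funext z
    rw [← intervalIntegral.integral_Iic_sub_Iic integrable_stdGaussianPDF.integrableOn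
      integrable_stdGaussianPDF.integrableOn]
    simp [stdGaussianCDF]
  rw [h]
  exact (continuous_stdGaussianPDF.integral_hasStrictDerivAt 0 z).hasDerivAt.add_const _

theorem stdGaussianPDF_neg (z : ℝ) : stdGaussianPDF (-z) = stdGaussianPDF z := by
  simp [stdGaussianPDF]

theorem hasDerivAt_stdGaussianPDF (z : ℝ) :
    HasDerivAt stdGaussianPDF (-z * stdGaussianPDF z) z := by
  have h := ((((hasDerivAt_id z).pow 2).neg.div_const 2).exp).const_mul
    (Real.sqrt (2 * Real.pi))⁻¹
  refine h.congr_deriv ?_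
  simp [stdGaussianPDF]
  ring

/-- The variance derivative of `d₊` is `-d₋ / (2y)`. -/
theorem hasDerivAt_dPlus (K r T x : ℝ) {y : ℝ} (hy : 0 < y) :
    HasDerivAt (dPlus K r T x) (-dMinus K r T x y / (2 * y)) y := by
  have hs : 0 < Real.sqrt y := Real.sqrt_pos.2 hy
  have h := (((hasDerivAt_id y).div_const 2).const_add (Real.log (x / K) + r * T)).div
    (Real.hasDerivAt_sqrt hy.ne') hs.ne'
  refine h.congr_deriv ?_
  simp only [dMinus, id]
  obtain ⟨s, hs', rfl⟩ : ∃ s : ℝ, 0 < s ∧ y = s ^ 2 := ⟨_, hs, (Real.sq_sqrt hy.le).symm⟩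
  rw [Real.sqrt_sq hs'.le]
  field_simp
  ring

/-- The variance derivative of `d₋` is `-d₊ / (2y)`. -/
theorem hasDerivAt_dMinus (K r T x : ℝ) {y : ℝ} (hy : 0 < y) :
    HasDerivAt (dMinus K r T x) (-dPlus K r T x y / (2 * y)) y := by
  have hs : 0 < Real.sqrt y := Real.sqrt_pos.2 hy
  have h := (((hasDerivAt_id y).div_const 2).const_sub (Real.log (x / K) + r * T)).div
    (Real.hasDerivAt_sqrt hy.ne') hs.ne'
  refine h.congr_deriv ?_
  simp only [dPlus, id]
  obtain ⟨s, hs', rfl⟩ : ∃ s : ℝ, 0 < s ∧ y = s ^ 2 := ⟨_, hs, (Real.sq_sqrt hy.le).symm⟩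
  rw [Real.sqrt_sq hs'.le]
  field_simp
  ring

theorem dPlus_sub_dMinus (K r T x y : ℝ) :
    dPlus K r T x y - dMinus K r T x y = Real.sqrt y := by
  rw [dPlus, dMinus, ← sub_div]
  exact (congrArg (· / Real.sqrt y) (by ring)).trans Real.div_sqrt

theorem mul_stdGaussianPDF_dMinus (r T : ℝ) {K x y : ℝ} (hK : 0 < K) (hx : 0 < x) (hy : 0 < y) :
    K * Real.exp (-(r * T)) * stdGaussianPDF (dMinus K r T x y) =
      x * stdGaussianPDF (dPlus K r T x y) := by
  have hd : -dMinus K r T x y ^ 2 / 2 =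
      -dPlus K r T x y ^ 2 / 2 + (Real.log (x / K) + r * T) := by
    simp only [dMinus, dPlus, div_pow, Real.sq_sqrt hy.le]
    field_simp
    ring
  rw [stdGaussianPDF, stdGaussianPDF, hd, Real.exp_add, Real.exp_add, Real.exp_neg,
    Real.exp_log (by positivity)]
  field_simp

theorem hasDerivAt_BSPut_variance (r T : ℝ) {K x y : ℝ} (hK : 0 < K) (hx : 0 < x) (hy : 0 < y) :
    HasDerivAt (BSPut K r T x)
      (x * stdGaussianPDF (dPlus K r T x y) / (2 * Real.sqrt y)) y := by
  have h := (((hasDerivAt_stdGaussianCDF _).comp y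
      (hasDerivAt_dMinus K r T x hy).neg).const_mul (K * Real.exp (-(r * T)))).sub
    (((hasDerivAt_stdGaussianCDF _).comp y (hasDerivAt_dPlus K r T x hy).neg).const_mul x)
  refine h.congr_deriv ?_
  simp only [Pi.neg_apply, stdGaussianPDF_neg]
  rw [← mul_assoc, mul_stdGaussianPDF_dMinus r T hK hx hy]
  have hs : 0 < Real.sqrt y := Real.sqrt_pos.2 hy
  have hd := dPlus_sub_dMinus K r T x y
  have hsq := Real.sq_sqrt hy.le
  field_simp
  linear_combination stdGaussianPDF (dPlus K r T x y) * (Real.sqrt y * hd + hsq)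

theorem hasDerivAt_vega (K r T x : ℝ) {y : ℝ} (hy : 0 < y) :
    HasDerivAt (fun y => x * stdGaussianPDF (dPlus K r T x y) / (2 * Real.sqrt y))
      (x * stdGaussianPDF (dPlus K r T x y) / (2 * Real.sqrt y) *
        ((dPlus K r T x y * dMinus K r T x y - 1) / (2 * y))) y := by
  have hs : 0 < Real.sqrt y := Real.sqrt_pos.2 hy
  have h := ((((hasDerivAt_stdGaussianPDF _).comp y (hasDerivAt_dPlus K r T x hy)).const_mul
    x).div ((Real.hasDerivAt_sqrt hy.ne').const_mul 2) (by positivity))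
  refine h.congr_deriv ?_
  have hsq := Real.sq_sqrt hy.le
  simp only [Function.comp_apply]
  generalize dPlus K r T x y = p, dMinus K r T x y = q at *
  generalize Real.sqrt y = s at *
  subst hsq
  field_simp

theorem hasDerivAt_vega_log_derivative (K r T x : ℝ) {y : ℝ} (hy : 0 < y) :
    HasDerivAt (fun y => (dPlus K r T x y * dMinus K r T x y - 1) / (2 * y))
      ((-(dPlus K r T x y ^ 2 + dMinus K r T x y ^ 2)
        - 2 * (dPlus K r T x y * dMinus K r T x y) + 2) / (4 * y ^ 2)) y := by
  have h := (((hasDerivAt_dPlus K r T x hy).mul (hasDerivAt_dMinus K r T x hy)).sub_const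
    1).div ((hasDerivAt_id y).const_mul 2) (by simpa using hy.ne')
  refine h.congr_deriv ?_
  simp only [id, Pi.mul_apply]
  field_simp
  ring

/-- Third derivative in the variance variable (formula (5.2)):
`∂³BS_Put/∂y³ = (x·φ(d₊)/(8y^{5/2}))·((d₋d₊ − 2)² − d₊² − d₋² − 1)` for all `x, y > 0`. -/
theorem bsPut_third_partial_yyy (K r T : ℝ) (hK : 0 < K) (hT : 0 < T) :
    ∀ x y : ℝ, 0 < x → 0 < y →
      iteratedDeriv 3 (fun y' => BSPut K r T x y') y =
        x * stdGaussianPDF (dPlus K r T x y) / (8 * y ^ ((5 : ℝ) / 2)) *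
          ((dMinus K r T x y * dPlus K r T x y - 2) ^ 2 -
            dPlus K r T x y ^ 2 - dMinus K r T x y ^ 2 - 1) := by
  intro x y hx hy
  have eventuallyEq_deriv {f g : ℝ → ℝ} (h : ∀ z, 0 < z → HasDerivAt f (g z) z)
      {z : ℝ} (hz : 0 < z) : deriv f =ᶠ[nhds z] g := by
    filter_upwards [lt_mem_nhds hz] with w hw using (h w hw).deriv
  have h₁ := eventuallyEq_deriv (fun z hz => hasDerivAt_BSPut_variance r T hK hx hz) hy
  have h₂ := eventuallyEq_deriv (fun z hz => hasDerivAt_vega K r T x hz) hy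
  have h₃ := (hasDerivAt_vega K r T x hy).mul (hasDerivAt_vega_log_derivative K r T x hy)
  rw [iteratedDeriv_succ, iteratedDeriv_succ, iteratedDeriv_one]
  refine ((h₁.deriv.trans h₂).deriv_eq.trans h₃.deriv).trans ?_
  have hpow : y ^ ((5 : ℝ) / 2) = y ^ 2 * Real.sqrt y := by
    rw [Real.sqrt_eq_rpow, ← Real.rpow_natCast, ← Real.rpow_add hy]
    norm_num
  have hs : 0 < Real.sqrt y := Real.sqrt_pos.2 hy
  rw [hpow]
  field_simp
  ring
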